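/- arXiv:2305.08976 — 3 statements merged into one kernel-verified Lean document; each statement's English description precedes it below -/
import Mathlib

section
/- Let m ∈ ℕ_{>0}, α > 0, real numbers t₁ > t₂ > ⋯ > t_m ≥ 0 and u₁, …, u_m ∈ ℝ. Then for every x ∈ (0,1], H_α(x; t, u) > 0. -/
open MeasureTheory Finset

/-- The upper incomplete Gamma function `Γ(a,x) = ∫_x^∞ s^(a-1) e^(-s) ds`. -/
noncomputable def incGamma (a x : ℝ) : ℝ := ∫ s in Set.Ioi x, s ^ (a - 1) * Real.exp (-s)

/-- The normalized incomplete Gamma function `Q(a,x) = Γ(a,x)/Γ(a)`. -/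
noncomputable def Qfun (a x : ℝ) : ℝ := incGamma a x / Real.Gamma a

/-- The function `H_α(x; t, u)`. -/
noncomputable def Hfun {m : ℕ} (α : ℝ) (t u : Fin m → ℝ) (x : ℝ) : ℝ :=
  1 + ∑ ℓ : Fin m, (Real.exp (u ℓ) - 1) * Real.exp (∑ j ∈ Finset.Ioi ℓ, u j) * Qfun α (t ℓ * x)

lemma integrableOn_rpow_mul_exp_neg_Ioi {a x : ℝ} (ha : 0 < a) (hx : 0 ≤ x) :
    IntegrableOn (fun s : ℝ => s ^ (a - 1) * Real.exp (-s)) (Set.Ioi x) := by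
  refine IntegrableOn.mono_set ?_ (Set.Ioi_subset_Ioi hx)
  simpa only [mul_comm] using Real.GammaIntegral_convergent ha

lemma incGamma_zero {a : ℝ} (ha : 0 < a) : incGamma a 0 = Real.Gamma a := by
  simp only [incGamma, Real.Gamma_eq_integral ha, mul_comm]

lemma incGamma_pos {a x : ℝ} (ha : 0 < a) (hx : 0 ≤ x) : 0 < incGamma a x := by
  have hpos : ∀ s ∈ Set.Ioi x, 0 < s ^ (a - 1) * Real.exp (-s) := fun s hs =>
    mul_pos (Real.rpow_pos_of_pos (hx.trans_lt hs) _) (Real.exp_pos _)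
  refine (setIntegral_pos_iff_support_of_nonneg_ae ?_
    (integrableOn_rpow_mul_exp_neg_Ioi ha hx)).2 ?_
  · exact (ae_restrict_mem measurableSet_Ioi).mono fun s hs => (hpos s hs).le
  · rw [Set.inter_eq_right.2 fun s hs => Function.mem_support.2 (hpos s hs).ne']
    simp

lemma incGamma_anti {a x y : ℝ} (ha : 0 < a) (hx : 0 ≤ x) (hxy : x ≤ y) :
    incGamma a y ≤ incGamma a x := by
  refine setIntegral_mono_set (integrableOn_rpow_mul_exp_neg_Ioi ha hx) ?_
    (Set.Ioi_subset_Ioi hxy).eventuallyLE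
  exact (ae_restrict_mem measurableSet_Ioi).mono fun s hs =>
    mul_nonneg (Real.rpow_nonneg (hx.trans (le_of_lt hs)) _) (Real.exp_pos _).le

lemma Qfun_pos {a x : ℝ} (ha : 0 < a) (hx : 0 ≤ x) : 0 < Qfun a x :=
  div_pos (incGamma_pos ha hx) (Real.Gamma_pos_of_pos ha)

lemma Qfun_anti {a x y : ℝ} (ha : 0 < a) (hx : 0 ≤ x) (hxy : x ≤ y) : Qfun a y ≤ Qfun a x :=
  div_le_div_of_nonneg_right (incGamma_anti ha hx hxy) (Real.Gamma_pos_of_pos ha).le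

lemma Qfun_le_one {a x : ℝ} (ha : 0 < a) (hx : 0 ≤ x) : Qfun a x ≤ 1 := by
  refine (Qfun_anti ha le_rfl hx).trans_eq ?_
  rw [Qfun, incGamma_zero ha, div_self (Real.Gamma_pos_of_pos ha).ne']

/-- A summation-by-parts positivity statement for monotone positive weights bounded by `c`. -/
lemma add_sum_exp_sub_one_mul_pos {m : ℕ} (u q : Fin m → ℝ) (c : ℝ) (hc : 0 < c)
    (hq : Monotone q) (hq0 : ∀ i, 0 < q i) (hqc : ∀ i, q i ≤ c) :
    0 < c + ∑ i, (Real.exp (u i) - 1) * Real.exp (∑ j ∈ Finset.Ioi i, u j) * q i := by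
  induction m generalizing c with
  | zero => simpa using hc
  | succ n ih =>
    have hsum : ∀ i : Fin n, ∑ j ∈ Finset.Ioi i.castSucc, u j =
        ∑ j ∈ Finset.Ioi i, u j.castSucc + u (Fin.last n) := fun i => by
      simp only [← Finset.filter_lt_eq_Ioi, Finset.sum_filter, Fin.sum_univ_castSucc,
        Fin.castSucc_lt_castSucc_iff, Fin.castSucc_lt_last, if_true]
    have hlast : Finset.Ioi (Fin.last n) = ∅ := by
      ext i; simpa using Fin.le_last i
    have key := ih (fun i => u i.castSucc) (fun i => q i.castSucc) (q (Fin.last n)) (hq0 _)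
      (fun i j hij => hq (Fin.castSucc_le_castSucc_iff.2 hij)) (fun i => hq0 _)
      (fun i => hq (Fin.le_last _))
    have hprod := mul_pos (Real.exp_pos (u (Fin.last n))) key
    rw [mul_add, Finset.mul_sum] at hprod
    simp only [Fin.sum_univ_castSucc, hsum, hlast, Finset.sum_empty, Real.exp_zero, mul_one,
      Real.exp_add]
    have hcomm : ∀ i : Fin n, (Real.exp (u i.castSucc) - 1) *
        (Real.exp (∑ j ∈ Finset.Ioi i, u j.castSucc) * Real.exp (u (Fin.last n))) * q i.castSucc =
        Real.exp (u (Fin.last n)) * ((Real.exp (u i.castSucc) - 1) *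
        Real.exp (∑ j ∈ Finset.Ioi i, u j.castSucc) * q i.castSucc) := fun i => by ring
    simp only [hcomm]
    linarith [hqc (Fin.last n)]

theorem statement0 (m : ℕ) (hm : 0 < m) (α : ℝ) (hα : 0 < α)
    (t u : Fin m → ℝ) (ht : StrictAnti t) (ht0 : ∀ ℓ, 0 ≤ t ℓ) :
    ∀ x ∈ Set.Ioc (0:ℝ) 1, 0 < Hfun α t u x := by
  rintro x ⟨hx, -⟩
  have hnn : ∀ ℓ, 0 ≤ t ℓ * x := fun ℓ => mul_nonneg (ht0 ℓ) hx.le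
  exact add_sum_exp_sub_one_mul_pos u (fun ℓ => Qfun α (t ℓ * x)) 1 one_pos
    (fun i j hij => Qfun_anti hα (hnn j) (mul_le_mul_of_nonneg_right (ht.antitone hij) hx.le))
    (fun ℓ => Qfun_pos hα (hnn ℓ)) (fun ℓ => Qfun_le_one hα (hnn ℓ))
end

section
/- For every real α > 0 and every K ∈ ℕ_{>0}, Σ_{j=1}^{K} ∏_{k=1}^{j−1} (K−k)/(K−k+α) = (K+α)/(1+α) (the empty product for j = 1 being equal to 1). -/
open Finset

/-- The partial sums telescope. -/
theorem sum_prod_div_add_eq_sub {α : ℝ} (hα : 0 < α) (K : ℕ) {m : ℕ} (hm : m ≤ K) :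
    ∑ j ∈ Finset.Icc 1 m, ∏ k ∈ Finset.Icc 1 (j - 1),
        (((K : ℝ) - (k : ℝ)) / ((K : ℝ) - (k : ℝ) + α))
      = ((K : ℝ) + α) / (1 + α) - (∏ k ∈ Finset.Icc 1 m,
        (((K : ℝ) - (k : ℝ)) / ((K : ℝ) - (k : ℝ) + α))) * (((K : ℝ) - m + α) / (1 + α)) := by
  induction m with
  | zero => simp
  | succ m ih =>
    have hmK : ((m + 1 : ℕ) : ℝ) ≤ K := by exact_mod_cast hm
    have hden : (K : ℝ) - ((m + 1 : ℕ) : ℝ) + α ≠ 0 := by linarith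
    have hα' : 1 + α ≠ 0 := by positivity
    rw [Finset.sum_Icc_succ_top (by omega), Finset.prod_Icc_succ_top (by omega),
      ih (by omega), Nat.add_sub_cancel]
    generalize ∏ k ∈ Finset.Icc 1 m, (((K : ℝ) - (k : ℝ)) / ((K : ℝ) - (k : ℝ) + α)) = P
    rw [mul_assoc, div_mul_div_cancel₀ hden]
    push_cast
    field_simp
    ring

theorem statement14 (α : ℝ) (hα : 0 < α) (K : ℕ) (hK : 0 < K) :
    ∑ j ∈ Finset.Icc 1 K, ∏ k ∈ Finset.Icc 1 (j - 1), (((K : ℝ) - (k : ℝ)) / ((K : ℝ) - (k : ℝ) + α))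
      = ((K : ℝ) + α) / (1 + α) := by
  rw [sum_prod_div_add_eq_sub hα K le_rfl,
    Finset.prod_eq_zero (Finset.mem_Icc.mpr ⟨hK, le_rfl⟩) (by simp), zero_mul, sub_zero]
end

section
/- Let m ∈ ℕ_{>0}, α > 0, t₁ > ⋯ > t_m ≥ 0 and u₁, …, u_m ∈ ℝ be fixed. For n ∈ ℕ_{>0} set r_ℓ := (1 − t_ℓ/n)^{1/2}, define ω_ℓ := e^{u_ℓ+⋯+u_m} − e^{u_{ℓ+1}+⋯+u_m} for 1 ≤ ℓ ≤ m−1, ω_m := e^{u_m} − 1, Ω := e^{u₁+⋯+u_m}, and 𝖳₀ := Σ_{ℓ=1}^m ω_ℓ t_ℓ^α. Let F_{n,j,ℓ} := I(r_ℓ², j, α), let M := n · (⌈n^{α/(2+α)}⌉)^{−1} (so M ≍ n^{2/(2+α)} and n/M ∈ ℕ), and set S₀ := Σ_{j=1}^{n/M − 1} ln(1 + Σ_{ℓ=1}^m ω_ℓ F_{n,j,ℓ}) (each argument of the logarithm being positive). Then as n → ∞, S₀ = (n/M − 1) ln Ω − (𝖳₀/(Ω Γ(2+α))) · n/M^{1+α}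 − (𝖳₀/(Ω Γ(1+α))) · ((α−2)/2) · M^{−α} + O( n/M^{2+α} + n/M^{1+2α} + M^{1−α}/n ). -/
open MeasureTheory Finset

/-- The incomplete Beta function `B(v, j, α) = ∫₀^v y^(j-1) (1-y)^(α-1) dy`. -/
noncomputable def incBeta (v : ℝ) (j : ℕ) (α : ℝ) : ℝ :=
  ∫ y in (0:ℝ)..v, y ^ (j - 1) * (1 - y) ^ (α - 1)

/-- The normalized incomplete Beta function `I(v, j, α) = B(v, j, α)/B(j, α)`. -/
noncomputable def normIncBeta (v : ℝ) (j : ℕ) (α : ℝ) : ℝ := incBeta v j α / incBeta 1 j α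

/-- The coefficient `ω_ℓ = e^{u_ℓ+⋯+u_m} − e^{u_{ℓ+1}+⋯+u_m}` (with `ω_m = e^{u_m} − 1`). -/
noncomputable def omegaCoef {m : ℕ} (u : Fin m → ℝ) (ℓ : Fin m) : ℝ :=
  Real.exp (∑ j ∈ Finset.Ici ℓ, u j) - Real.exp (∑ j ∈ Finset.Ioi ℓ, u j)

/-- `Ω = e^{u₁+⋯+u_m}`. -/
noncomputable def OmegaTot {m : ℕ} (u : Fin m → ℝ) : ℝ := Real.exp (∑ j, u j)

/-- `𝖳₀ = Σ_ℓ ω_ℓ t_ℓ^α`. -/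
noncomputable def Tzero {m : ℕ} (α : ℝ) (t u : Fin m → ℝ) : ℝ :=
  ∑ ℓ : Fin m, omegaCoef u ℓ * t ℓ ^ α

/-- The parameter `M = n · (⌈n^{α/(2+α)}⌉)⁻¹`, so that `n/M = ⌈n^{α/(2+α)}⌉ ∈ ℕ`. -/
noncomputable def Mpar (n : ℕ) (α : ℝ) : ℝ :=
  (n : ℝ) * ((⌈(n : ℝ) ^ (α / (2 + α))⌉₊ : ℝ))⁻¹

open Filter Topology

/-- The ratio `Γ(j + α) / Γ(j)`. -/
noncomputable def gammaRatio (α : ℝ) (j : ℕ) : ℝ := Real.Gamma (j + α) / Real.Gamma j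

lemma gammaRatio_pos {α : ℝ} (hα : 0 < α) {j : ℕ} (hj : 0 < j) : 0 < gammaRatio α j := by
  have : (0 : ℝ) < j := by exact_mod_cast hj
  exact div_pos (Real.Gamma_pos_of_pos (by positivity)) (Real.Gamma_pos_of_pos this)

lemma gammaRatio_succ {α : ℝ} (hα : 0 < α) {j : ℕ} (hj : 0 < j) :
    gammaRatio α (j + 1) = (j + α) / j * gammaRatio α j := by
  have h : (0 : ℝ) < j := by exact_mod_cast hj
  have h1 : Real.Gamma ((j : ℝ) + 1 + α) = (j + α) * Real.Gamma (j + α) := by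
    rw [← Real.Gamma_add_one (by positivity)]; congr 1; ring
  unfold gammaRatio
  push_cast
  rw [h1, Real.Gamma_add_one h.ne']
  have := (Real.Gamma_pos_of_pos h).ne'
  field_simp

lemma sum_gammaRatio {α : ℝ} (hα : 0 < α) {N : ℕ} (hN : 0 < N) :
    ∑ j ∈ Finset.Icc 1 (N - 1), gammaRatio α j = (N - 1) * gammaRatio α N / (1 + α) := by
  induction N, hN using Nat.le_induction with
  | base => simp
  | succ k hk ih =>
    obtain ⟨k, rfl⟩ : ∃ l, k = l + 1 := ⟨k - 1, by omega⟩
    simp only [Nat.add_sub_cancel] at ih ⊢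
    rw [Finset.sum_Icc_succ_top (by omega), ih, gammaRatio_succ (j := k + 1) hα (by omega)]
    push_cast
    have : (k : ℝ) + 1 ≠ 0 := by positivity
    field_simp
    ring

lemma Gamma_mul_prod_add {α : ℝ} (hα : 0 < α) (n : ℕ) :
    Real.Gamma α * ∏ j ∈ Finset.range n, (α + j) = Real.Gamma (n + α) := by
  induction n with
  | zero => simp
  | succ k ih =>
    rw [Finset.prod_range_succ, ← mul_assoc, ih]
    push_cast
    rw [mul_comm, add_comm α, ← Real.Gamma_add_one (by positivity)]
    congr 1; ring

lemma tendsto_gammaRatio_div_rpow {α : ℝ} (hα : 0 < α) :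
    Tendsto (fun n : ℕ => gammaRatio α n / (n : ℝ) ^ α) atTop (𝓝 1) := by
  have hΓ := (Real.Gamma_pos_of_pos hα).ne'
  have h1 := (tendsto_const_nhds (x := Real.Gamma α)).div (Real.GammaSeq_tendsto_Gamma α) hΓ
  have h2 := h1.mul (tendsto_natCast_div_add_atTop (𝕜 := ℝ) α)
  rw [div_self hΓ, one_mul] at h2
  refine h2.congr' ?_
  filter_upwards [eventually_gt_atTop 0] with n hn
  have hn' : (0 : ℝ) < n := by exact_mod_cast hn
  have e : (n.factorial : ℝ) = n * Real.Gamma n := by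
    rw [← Real.Gamma_nat_eq_factorial, Real.Gamma_add_one hn'.ne']
  have e2 : Real.Gamma α * ∏ j ∈ Finset.range (n + 1), (α + (j : ℝ))
      = (n + α) * Real.Gamma (n + α) := by
    rw [Gamma_mul_prod_add hα, ← Real.Gamma_add_one (by positivity)]
    push_cast; congr 1; ring
  have hp : ∏ j ∈ Finset.range (n + 1), (α + (j : ℝ)) =
      (n + α) * Real.Gamma (n + α) / Real.Gamma α := by
    rw [← e2]; field_simp
  have := (Real.Gamma_pos_of_pos hn').ne'
  have : Real.Gamma (n + α) ≠ 0 := (Real.Gamma_pos_of_pos (by positivity)).ne'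
  have : (n : ℝ) ^ α ≠ 0 := by positivity
  simp only [Pi.div_apply]
  unfold Real.GammaSeq gammaRatio
  rw [hp, e]
  field_simp

lemma exists_gammaRatio_le {α : ℝ} (hα : 0 < α) :
    ∃ K > 0, ∀ j : ℕ, 0 < j → gammaRatio α j ≤ K * (j : ℝ) ^ α := by
  obtain ⟨K, hK⟩ := (tendsto_gammaRatio_div_rpow hα).bddAbove_range
  refine ⟨max K 1, by positivity, fun j hj => ?_⟩
  have hj' : (0 : ℝ) < j := by exact_mod_cast hj
  rw [← div_le_iff₀ (by positivity)]
  exact (hK ⟨j, rfl⟩).trans (le_max_left _ _)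

/-- `log (Γ(n + α) / Γ(n)) - α log n - α (α - 1) / (2 n)`. -/
noncomputable def gammaRatioLogErr (α : ℝ) (n : ℕ) : ℝ :=
  Real.log (gammaRatio α n) - α * Real.log n - α * (α - 1) / 2 / n

lemma tendsto_gammaRatioLogErr {α : ℝ} (hα : 0 < α) :
    Tendsto (gammaRatioLogErr α) atTop (𝓝 0) := by
  have h := (tendsto_gammaRatio_div_rpow hα).log one_ne_zero
  rw [Real.log_one] at h
  have h2 := h.sub (tendsto_const_div_atTop_nhds_zero_nat (α * (α - 1) / 2))
  rw [sub_zero] at h2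
  refine h2.congr' ?_
  filter_upwards [eventually_gt_atTop 0] with n hn
  have hn' : (0 : ℝ) < n := by exact_mod_cast hn
  rw [gammaRatioLogErr, Real.log_div (gammaRatio_pos hα hn).ne' (by positivity),
    Real.log_rpow hn']

lemma abs_log_one_add_sub_le {x : ℝ} (h0 : 0 ≤ x) (h1 : x ≤ 1 / 2) :
    |Real.log (1 + x) - (x - x ^ 2 / 2)| ≤ 2 * x ^ 3 := by
  have h := Real.abs_log_sub_add_sum_range_le (x := -x)
    (by rw [abs_neg, abs_of_nonneg h0]; linarith) 2
  rw [abs_neg, abs_of_nonneg h0] at h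
  simp only [Finset.sum_range_succ, Finset.sum_range_zero] at h
  norm_num at h
  refine (le_of_eq ?_).trans (h.trans ?_)
  · congr 1; ring
  · rw [div_le_iff₀ (by linarith)]
    have : 0 ≤ x ^ 3 := by positivity
    nlinarith

lemma abs_gammaRatioLogErr_succ_sub_le {α : ℝ} (hα : 0 < α) {n : ℕ} (hn : 0 < n)
    (h2 : 2 ≤ (n : ℝ)) (h2α : 2 * α ≤ n) :
    |gammaRatioLogErr α (n + 1) - gammaRatioLogErr α n|
      ≤ (2 * α ^ 3 + 2 * α + |α * (α - 1) / 2|) / (n : ℝ) ^ 3 := by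
  have hn' : (0 : ℝ) < n := by exact_mod_cast hn
  set β := α * (α - 1) / 2 with hβ
  have A := abs_log_one_add_sub_le (x := α / n) (by positivity)
    (by rw [div_le_iff₀ hn']; linarith)
  have B := abs_log_one_add_sub_le (x := 1 / n) (by positivity)
    (by rw [div_le_iff₀ hn']; linarith)
  have e : gammaRatioLogErr α (n + 1) - gammaRatioLogErr α n
      = (Real.log (1 + α / n) - (α / n - (α / n) ^ 2 / 2))
        - α * (Real.log (1 + 1 / n) - (1 / n - (1 / n) ^ 2 / 2))
        - β * (1 / (n ^ 2 * (n + 1))) := by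
    unfold gammaRatioLogErr
    rw [← hβ, gammaRatio_succ hα hn, Real.log_mul (by positivity) (gammaRatio_pos hα hn).ne']
    have e1 : (n + α) / n = 1 + α / n := by field_simp
    have e2 : Real.log ((n + 1 : ℕ) : ℝ) = Real.log n + Real.log (1 + 1 / n) := by
      rw [← Real.log_mul hn'.ne' (by positivity)]
      congr 1; push_cast; field_simp
    rw [e1, e2]
    push_cast
    have : (n : ℝ) + 1 ≠ 0 := by positivity
    rw [hβ]
    field_simp
    ring
  rw [e]
  have D : |β * (1 / (n ^ 2 * (n + 1)))| ≤ |β| * (1 / (n : ℝ) ^ 3) := by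
    rw [abs_mul]
    gcongr
    rw [abs_of_pos (by positivity)]
    gcongr
    nlinarith
  have E := abs_sub (Real.log (1 + α / n) - (α / n - (α / n) ^ 2 / 2)
        - α * (Real.log (1 + 1 / n) - (1 / n - (1 / n) ^ 2 / 2))) (β * (1 / (n ^ 2 * (n + 1))))
  have F := abs_sub (Real.log (1 + α / n) - (α / n - (α / n) ^ 2 / 2))
        (α * (Real.log (1 + 1 / n) - (1 / n - (1 / n) ^ 2 / 2)))
  rw [abs_mul, abs_of_pos hα] at F
  have G := mul_le_mul_of_nonneg_left B hα.le
  have : (2 * α ^ 3 + 2 * α + |β|) / (n : ℝ) ^ 3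
    = 2 * (α / n) ^ 3 + α * (2 * (1 / n) ^ 3) + |β| * (1 / (n : ℝ) ^ 3) := by
    field_simp
  linarith

lemma abs_le_div_sq_of_abs_succ_sub_le {c : ℕ → ℝ} (hc : Tendsto c atTop (𝓝 0)) {K : ℝ}
    (hK : 0 ≤ K) {n₀ : ℕ} (hn₀ : 0 < n₀)
    (h : ∀ n ≥ n₀, |c (n + 1) - c n| ≤ K / (n : ℝ) ^ 3) :
    ∀ n ≥ n₀, |c n| ≤ 2 * K / (n : ℝ) ^ 2 := by
  have hlim : Tendsto (fun n : ℕ => 2 * K / (n : ℝ) ^ 2) atTop (𝓝 0) :=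
    tendsto_const_nhds.div_atTop
      ((tendsto_pow_atTop two_ne_zero).comp tendsto_natCast_atTop_atTop)
  have step : ∀ n ≥ n₀, K / (n : ℝ) ^ 3 ≤ 2 * K / (n : ℝ) ^ 2 - 2 * K / ((n + 1 : ℕ) : ℝ) ^ 2 := by
    intro n hn
    have h1 : (1 : ℝ) ≤ n := by exact_mod_cast (by omega : 1 ≤ n)
    have h0 : (0 : ℝ) < n := by linarith
    have key : 1 / (n : ℝ) ^ 3 ≤ 2 / (n : ℝ) ^ 2 - 2 / ((n : ℝ) + 1) ^ 2 := by
      rw [div_sub_div _ _ (by positivity) (by positivity), div_le_div_iff₀ (by positivity)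
        (by positivity)]
      have : 0 ≤ (n : ℝ) ^ 2 * (3 * n ^ 2 - 1) := by
        apply mul_nonneg (by positivity); nlinarith
      nlinarith
    push_cast
    calc K / (n : ℝ) ^ 3 = K * (1 / (n : ℝ) ^ 3) := by ring
      _ ≤ K * (2 / (n : ℝ) ^ 2 - 2 / ((n : ℝ) + 1) ^ 2) := by gcongr
      _ = _ := by ring
  intro n hn
  rw [abs_le]
  constructor
  · have hanti : ∀ k, c (n + k) + 2 * K / ((n + k : ℕ) : ℝ) ^ 2 ≤ c n + 2 * K / (n : ℝ) ^ 2 := by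
      intro k
      induction k with
      | zero => simp
      | succ k ih =>
        have h1 := (abs_le.mp (h (n + k) (by omega))).2
        have h2 := step (n + k) (by omega)
        rw [← add_assoc]
        linarith
    have hl : Tendsto (fun k => c (n + k) + 2 * K / ((n + k : ℕ) : ℝ) ^ 2) atTop (𝓝 0) := by
      have := (hc.add hlim).comp (tendsto_add_atTop_nat n)
      rw [add_zero] at this
      refine this.congr fun k => ?_
      simp [add_comm]
    have := le_of_tendsto' hl hanti
    linarith
  · have hmono : ∀ k, c n - 2 * K / (n : ℝ) ^ 2 ≤ c (n + k) - 2 * K / ((n + k : ℕ) : ℝ) ^ 2 := by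
      intro k
      induction k with
      | zero => simp
      | succ k ih =>
        have h1 := (abs_le.mp (h (n + k) (by omega))).1
        have h2 := step (n + k) (by omega)
        rw [← add_assoc]
        linarith
    have hl : Tendsto (fun k => c (n + k) - 2 * K / ((n + k : ℕ) : ℝ) ^ 2) atTop (𝓝 0) := by
      have := (hc.sub hlim).comp (tendsto_add_atTop_nat n)
      rw [sub_zero] at this
      refine this.congr fun k => ?_
      simp [add_comm]
    have := ge_of_tendsto' hl hmono
    linarith

/-- Second-order asymptotics of `Γ(n + α) / Γ(n)`. -/
lemma exists_abs_gammaRatio_sub_le {α : ℝ} (hα : 0 < α) :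
    ∃ C > 0, ∀ᶠ n : ℕ in atTop,
      |gammaRatio α n - (n : ℝ) ^ α * (1 + α * (α - 1) / 2 / n)|
        ≤ C * ((n : ℝ) ^ α / (n : ℝ) ^ 2) := by
  set β := α * (α - 1) / 2 with hβ
  set K := 2 * α ^ 3 + 2 * α + |β| with hK
  have hK0 : 0 < K := by positivity
  refine ⟨(|β| + 2 * K) ^ 2 + 2 * K, by positivity, ?_⟩
  obtain ⟨n₀, hn₀⟩ := exists_nat_ge (max 2 (2 * α))
  have hn₀2 : 0 < n₀ := by
    have := (le_max_left _ _).trans hn₀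
    exact_mod_cast (by linarith : (0 : ℝ) < n₀)
  have hc : ∀ n ≥ n₀, |gammaRatioLogErr α n| ≤ 2 * K / (n : ℝ) ^ 2 := by
    refine abs_le_div_sq_of_abs_succ_sub_le (tendsto_gammaRatioLogErr hα) hK0.le hn₀2 ?_
    intro n hn
    have : (n₀ : ℝ) ≤ n := by exact_mod_cast hn
    exact abs_gammaRatioLogErr_succ_sub_le hα (by omega)
      (((le_max_left _ _).trans hn₀).trans this) (((le_max_right _ _).trans hn₀).trans this)
  obtain ⟨n₁, hn₁⟩ := exists_nat_ge (|β| + 2 * K)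
  filter_upwards [eventually_ge_atTop n₀, eventually_ge_atTop n₁] with n hn hn'
  have hnpos : 0 < n := by omega
  have hn1 : (1 : ℝ) ≤ n := by exact_mod_cast hnpos
  have hn0 : (0 : ℝ) < n := by linarith
  have hn2 : |β| + 2 * K ≤ n := hn₁.trans (by exact_mod_cast hn')
  have hc' := hc n hn
  set c := gammaRatioLogErr α n with hcdef
  have hb : gammaRatio α n = (n : ℝ) ^ α * Real.exp (β / n + c) := by
    rw [hcdef, gammaRatioLogErr, ← hβ, Real.rpow_def_of_pos hn0, ← Real.exp_add]
    rw [show Real.log n * α + (β / n + (Real.log (gammaRatio α n) - α * Real.log n - β / n))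
      = Real.log (gammaRatio α n) by ring, Real.exp_log (gammaRatio_pos hα hnpos)]
  have hx : |β / n + c| ≤ (|β| + 2 * K) / n := by
    refine (abs_add_le _ _).trans ?_
    rw [abs_div, abs_of_pos hn0, add_div]
    have : 2 * K / (n : ℝ) ^ 2 ≤ 2 * K / n := by gcongr; nlinarith
    linarith
  have hexp := Real.abs_exp_sub_one_sub_id_le (x := β / n + c)
    (hx.trans ((div_le_one hn0).mpr hn2))
  have hsq : (β / n + c) ^ 2 ≤ (|β| + 2 * K) ^ 2 / (n : ℝ) ^ 2 := by
    rw [← sq_abs, ← div_pow]; gcongr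
  rw [hb, ← mul_sub, abs_mul, abs_of_pos (by positivity)]
  have : |Real.exp (β / n + c) - (1 + β / n)| ≤ ((|β| + 2 * K) ^ 2 + 2 * K) / (n : ℝ) ^ 2 := by
    have := abs_add_le (Real.exp (β / n + c) - 1 - (β / n + c)) c
    rw [show Real.exp (β / n + c) - 1 - (β / n + c) + c = Real.exp (β / n + c) - (1 + β / n) by ring]
      at this
    rw [add_div]
    linarith
  calc _ ≤ (n : ℝ) ^ α * (((|β| + 2 * K) ^ 2 + 2 * K) / (n : ℝ) ^ 2) := by gcongr
    _ = _ := by ring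

/-- First-order form of the expansion of `∑ Γ(j + α) / Γ(j)` over `1 ≤ j < N`. -/
lemma exists_abs_sum_gammaRatio_sub_le {α : ℝ} (hα : 0 < α) :
    ∃ C > 0, ∀ᶠ N : ℕ in atTop,
      |∑ j ∈ Finset.Icc 1 (N - 1), gammaRatio α j
          - ((N : ℝ) * (N : ℝ) ^ α / (1 + α) + (α - 2) / 2 * (N : ℝ) ^ α)|
        ≤ C * ((N : ℝ) ^ α / N) := by
  obtain ⟨C, hC, h⟩ := exists_abs_gammaRatio_sub_le hα
  refine ⟨(|α * (α - 1) / 2| + C) / (1 + α), by positivity, ?_⟩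
  filter_upwards [h, eventually_gt_atTop 0] with N hN hpos
  have h1 : (1 : ℝ) ≤ N := by exact_mod_cast hpos
  have h0 : (0 : ℝ) < N := by linarith
  rw [sum_gammaRatio hα hpos]
  set e := gammaRatio α N - (N : ℝ) ^ α * (1 + α * (α - 1) / 2 / N) with he
  have hb : gammaRatio α N = (N : ℝ) ^ α * (1 + α * (α - 1) / 2 / N) + e := by rw [he]; ring
  have key : (N - 1) * gammaRatio α N / (1 + α)
      - ((N : ℝ) * (N : ℝ) ^ α / (1 + α) + (α - 2) / 2 * (N : ℝ) ^ α)
      = (-(α * (α - 1) / 2) * ((N : ℝ) ^ α / N) + (N - 1) * e) / (1 + α) := by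
    rw [hb]
    have : 1 + α ≠ 0 := by positivity
    field_simp
    ring
  rw [key, abs_div, abs_of_pos (by positivity : 0 < 1 + α), div_mul_eq_mul_div]
  gcongr
  refine (abs_add_le _ _).trans ?_
  rw [add_mul]
  gcongr
  · rw [abs_mul, abs_neg, abs_of_nonneg (by positivity : 0 ≤ (N : ℝ) ^ α / N)]
  · rw [abs_mul, abs_of_nonneg (by linarith)]
    calc ((N : ℝ) - 1) * |e| ≤ N * (C * ((N : ℝ) ^ α / (N : ℝ) ^ 2)) := by
          gcongr
          linarith
      _ = _ := by field_simp

lemma intervalIntegrable_incBeta {α : ℝ} (hα : 0 < α) (j : ℕ) (a b : ℝ) :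
    IntervalIntegrable (fun y : ℝ => y ^ (j - 1) * (1 - y) ^ (α - 1)) volume a b := by
  have h : IntervalIntegrable (fun y : ℝ => (1 - y) ^ (α - 1)) volume a b := by
    have := (intervalIntegral.intervalIntegrable_rpow' (a := 1 - a) (b := 1 - b)
      (by linarith : -1 < α - 1)).comp_sub_left 1
    simpa using this
  exact h.continuousOn_mul (by fun_prop)

lemma incBeta_one_sub {α : ℝ} (hα : 0 < α) (j : ℕ) (x : ℝ) :
    incBeta 1 j α - incBeta (1 - x) j α
      = ∫ s in (0 : ℝ)..x, (1 - s) ^ (j - 1) * s ^ (α - 1) := by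
  unfold incBeta
  rw [intervalIntegral.integral_interval_sub_left (intervalIntegrable_incBeta hα j _ _)
    (intervalIntegrable_incBeta hα j _ _)]
  have := intervalIntegral.integral_comp_sub_left (a := 0) (b := x)
    (fun y : ℝ => y ^ (j - 1) * (1 - y) ^ (α - 1)) 1
  simpa using this.symm

lemma incBeta_one_eq {α : ℝ} (hα : 0 < α) {j : ℕ} (hj : 0 < j) :
    incBeta 1 j α = Real.Gamma α / gammaRatio α j := by
  have hj' : (0 : ℝ) < j := by exact_mod_cast hj
  have h : ProbabilityTheory.beta j α = incBeta 1 j α := by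
    rw [ProbabilityTheory.beta_eq_betaIntegralReal _ _ hj' hα, Complex.betaIntegral, incBeta]
    have : (∫ x in (0 : ℝ)..1, (x : ℂ) ^ (((j : ℝ) : ℂ) - 1) * (1 - (x : ℂ)) ^ ((α : ℂ) - 1))
        = ∫ x in (0 : ℝ)..1, ((x ^ (j - 1) * (1 - x) ^ (α - 1) : ℝ) : ℂ) := by
      refine intervalIntegral.integral_congr fun x hx => ?_
      rw [Set.uIcc_of_le zero_le_one] at hx
      have e : ((j : ℝ) : ℂ) - 1 = ((j - 1 : ℕ) : ℂ) := by
        push_cast [Nat.cast_sub hj]; rfl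
      rw [e, Complex.cpow_natCast]
      push_cast
      rw [Complex.ofReal_cpow (by linarith [hx.2])]
      push_cast
      rfl
    rw [this, intervalIntegral.integral_ofReal, Complex.ofReal_re]
  rw [← h, ProbabilityTheory.beta, gammaRatio]
  have := (Real.Gamma_pos_of_pos hj').ne'
  field_simp

lemma abs_integral_one_sub_pow_mul_rpow_sub_le {α : ℝ} (hα : 0 < α) {j : ℕ} (hj : 0 < j) {x : ℝ}
    (hx0 : 0 ≤ x) (hx1 : x ≤ 1) :
    |(∫ s in (0 : ℝ)..x, (1 - s) ^ (j - 1) * s ^ (α - 1)) - x ^ α / α| ≤ j * x ^ (α + 1) := by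
  have i1 : IntervalIntegrable (fun s : ℝ => s ^ (α - 1)) volume 0 x :=
    intervalIntegral.intervalIntegrable_rpow' (by linarith)
  have i2 : IntervalIntegrable (fun s : ℝ => (1 - s) ^ (j - 1) * s ^ (α - 1)) volume 0 x :=
    i1.continuousOn_mul (by fun_prop)
  have i3 : IntervalIntegrable (fun s : ℝ => (j : ℝ) * s ^ α) volume 0 x :=
    (intervalIntegral.intervalIntegrable_rpow' (by linarith)).const_mul _
  have v1 : ∫ s in (0 : ℝ)..x, s ^ (α - 1) = x ^ α / α := by
    rw [integral_rpow (Or.inl (by linarith))]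
    simp [Real.zero_rpow hα.ne']
  have v3 : ∫ s in (0 : ℝ)..x, (j : ℝ) * s ^ α = j * (x ^ (α + 1) / (α + 1)) := by
    rw [intervalIntegral.integral_const_mul, integral_rpow (Or.inl (by linarith))]
    simp [Real.zero_rpow (by linarith : α + 1 ≠ 0)]
  have up : (∫ s in (0 : ℝ)..x, (1 - s) ^ (j - 1) * s ^ (α - 1)) ≤ x ^ α / α := by
    rw [← v1]
    refine intervalIntegral.integral_mono_on hx0 i2 i1 fun s hs => ?_
    have : 0 ≤ s ^ (α - 1) := Real.rpow_nonneg hs.1 _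
    exact mul_le_of_le_one_left this
      (pow_le_one₀ (by linarith [hs.2]) (by linarith [hs.1]))
  have low : x ^ α / α - j * (x ^ (α + 1) / (α + 1))
      ≤ ∫ s in (0 : ℝ)..x, (1 - s) ^ (j - 1) * s ^ (α - 1) := by
    rw [← v1, ← v3, ← intervalIntegral.integral_sub i1 i3]
    refine intervalIntegral.integral_mono_on_of_le_Ioo hx0 (i1.sub i3) i2 fun s hs => ?_
    have hp : 0 ≤ s ^ (α - 1) := Real.rpow_nonneg hs.1.le _
    have e : s ^ α = s * s ^ (α - 1) := by
      rw [Real.rpow_sub_one hs.1.ne']; field_simp [hs.1.ne']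
    have hb := one_add_mul_le_pow (a := -s) (by linarith [hs.2]) (j - 1)
    have hj' : ((j - 1 : ℕ) : ℝ) ≤ j := by exact_mod_cast Nat.sub_le _ _
    have hjs : ((j - 1 : ℕ) : ℝ) * s ≤ j * s := mul_le_mul_of_nonneg_right hj' hs.1.le
    have hb' : 1 - j * s ≤ (1 - s) ^ (j - 1) := by
      rw [← sub_eq_add_neg] at hb; linarith
    rw [e]
    nlinarith [mul_le_mul_of_nonneg_right hb' hp]
  have hpos : 0 ≤ (j : ℝ) * x ^ (α + 1) := by positivity
  have hle : j * (x ^ (α + 1) / (α + 1)) ≤ (j : ℝ) * x ^ (α + 1) := by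
    gcongr
    exact div_le_self (by positivity) (by linarith)
  rw [abs_le]
  constructor <;> linarith

lemma abs_one_sub_normIncBeta_sub_le {α : ℝ} (hα : 0 < α) {j : ℕ} (hj : 0 < j) {x : ℝ}
    (hx0 : 0 ≤ x) (hx1 : x ≤ 1) :
    |1 - normIncBeta (1 - x) j α - gammaRatio α j * x ^ α / Real.Gamma (1 + α)|
      ≤ gammaRatio α j * (j * x ^ (α + 1)) / Real.Gamma α := by
  have hb := gammaRatio_pos hα hj
  have hΓ := Real.Gamma_pos_of_pos hα
  have h1 : Real.Gamma (1 + α) = α * Real.Gamma α := by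
    rw [add_comm, Real.Gamma_add_one hα.ne']
  have e : 1 - normIncBeta (1 - x) j α - gammaRatio α j * x ^ α / Real.Gamma (1 + α)
      = gammaRatio α j / Real.Gamma α *
        ((∫ s in (0 : ℝ)..x, (1 - s) ^ (j - 1) * s ^ (α - 1)) - x ^ α / α) := by
    rw [← incBeta_one_sub hα, normIncBeta, incBeta_one_eq hα hj, h1]
    field_simp
  rw [e, abs_mul, abs_of_pos (by positivity)]
  calc _ ≤ gammaRatio α j / Real.Gamma α * (j * x ^ (α + 1)) := by
        gcongr
        exact abs_integral_one_sub_pow_mul_rpow_sub_le hα hj hx0 hx1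
    _ = _ := by ring

lemma one_add_sum_omegaCoef {m : ℕ} (u : Fin m → ℝ) :
    1 + ∑ ℓ, omegaCoef u ℓ = OmegaTot u := by
  set g : ℕ → ℝ := fun k => Real.exp (∑ j ∈ Finset.univ.filter (fun j : Fin m => k ≤ j), u j)
    with hg
  have h : ∀ ℓ : Fin m, omegaCoef u ℓ = g ℓ - g (ℓ + 1) := by
    intro ℓ
    have h1 : Finset.univ.filter (fun j : Fin m => (ℓ : ℕ) ≤ j) = Finset.Ici ℓ := by
      ext j; simp
    have h2 : Finset.univ.filter (fun j : Fin m => (ℓ : ℕ) + 1 ≤ j) = Finset.Ioi ℓ := by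
      ext j; simp
    simp only [hg, omegaCoef, h1, h2]
  have hm : Finset.univ.filter (fun j : Fin m => m ≤ (j : ℕ)) = ∅ := by
    ext j; simp
  rw [Finset.sum_congr rfl fun ℓ _ => h ℓ, Fin.sum_univ_eq_sum_range (fun k => g k - g (k + 1)),
    Finset.sum_range_sub']
  simp [hg, hm, OmegaTot]

lemma abs_log_sub_sub_le {Ω X : ℝ} (hΩ : 0 < Ω) (hX : |X| ≤ Ω / 2) :
    |Real.log (Ω - X) - (Real.log Ω - X / Ω)| ≤ 2 * X ^ 2 / Ω ^ 2 := by
  have hy : |X / Ω| ≤ 1 / 2 := by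
    rw [abs_div, abs_of_pos hΩ, div_le_iff₀ hΩ]; linarith
  have h := Real.abs_log_sub_add_sum_range_le (x := X / Ω) (by linarith) 1
  have hne : 1 - X / Ω ≠ 0 := by
    have := (abs_le.mp hy).2
    linarith
  have e : Real.log (Ω - X) = Real.log Ω + Real.log (1 - X / Ω) := by
    rw [← Real.log_mul hΩ.ne' hne]; congr 1; field_simp
  rw [e]
  simp only [Finset.sum_range_succ, Finset.sum_range_zero] at h
  norm_num at h
  rw [show Real.log Ω + Real.log (1 - X / Ω) - (Real.log Ω - X / Ω)
    = X / Ω + Real.log (1 - X / Ω) by ring]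
  refine h.trans ?_
  rw [div_le_iff₀ (by linarith)]
  have : 0 ≤ (X / Ω) ^ 2 := by positivity
  rw [mul_div_assoc, ← div_pow]
  nlinarith

lemma exists_abs_log_term_sub_le {m : ℕ} {α : ℝ} (hα : 0 < α) {t : Fin m → ℝ} (u : Fin m → ℝ)
    (ht0 : ∀ ℓ, 0 ≤ t ℓ) :
    ∃ C > 0, ∃ δ > 0, ∀ n : ℕ, 0 < n → (∀ ℓ, t ℓ ≤ n) → ∀ j : ℕ, 0 < j →
      (j : ℝ) / n ≤ 1 → ((j : ℝ) / n) ^ α ≤ δ →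
      |Real.log (1 + ∑ ℓ : Fin m,
            omegaCoef u ℓ * normIncBeta (Real.sqrt (1 - t ℓ / n) ^ 2) j α)
        - (Real.log (OmegaTot u)
          - Tzero α t u / (OmegaTot u * Real.Gamma (1 + α)) / (n : ℝ) ^ α * gammaRatio α j)|
      ≤ C * (((j : ℝ) / n) ^ (α + 1) + ((j : ℝ) / n) ^ (2 * α)) := by
  obtain ⟨K, hK, hb⟩ := exists_gammaRatio_le hα
  have hΩ : 0 < OmegaTot u := Real.exp_pos _
  have hΓ := Real.Gamma_pos_of_pos hα
  have hΓ1 : 0 < Real.Gamma (1 + α) := Real.Gamma_pos_of_pos (by linarith)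
  set Ω := OmegaTot u with hΩ_def
  set T := Tzero α t u with hT
  set K₁ := ∑ ℓ, |omegaCoef u ℓ| * (K * t ℓ ^ (α + 1) / Real.Gamma α) with hK₁
  have hK₁0 : 0 ≤ K₁ := Finset.sum_nonneg fun ℓ _ => by
    have := Real.rpow_nonneg (ht0 ℓ) (α + 1)
    positivity
  set K₃ := |T| * K / Real.Gamma (1 + α) + K₁ + 1 with hK₃
  have hK₃0 : 0 < K₃ := by positivity
  refine ⟨K₁ / Ω + 2 * K₃ ^ 2 / Ω ^ 2, by positivity, Ω / 2 / K₃, by positivity, ?_⟩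
  intro n hn htn j hj hq1 hqδ
  have hn' : (0 : ℝ) < n := by exact_mod_cast hn
  have hj' : (0 : ℝ) < j := by exact_mod_cast hj
  have hbj := hb j hj
  have hbpos := gammaRatio_pos hα hj
  set b := gammaRatio α j
  set q := (j : ℝ) / n with hq
  have hq0 : 0 < q := by positivity
  have hqα : q ^ α = (j : ℝ) ^ α / (n : ℝ) ^ α := Real.div_rpow hj'.le hn'.le _
  have hqα1 : q ^ (α + 1) = (j : ℝ) ^ α * j / (n : ℝ) ^ (α + 1) := by
    rw [hq, Real.div_rpow hj'.le hn'.le, Real.rpow_add_one hj'.ne']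
  set X := ∑ ℓ, omegaCoef u ℓ * (1 - normIncBeta (1 - t ℓ / n) j α) with hX
  have harg : 1 + ∑ ℓ : Fin m, omegaCoef u ℓ * normIncBeta (Real.sqrt (1 - t ℓ / n) ^ 2) j α
      = Ω - X := by
    rw [hX, hΩ_def, ← one_add_sum_omegaCoef u, add_sub_assoc, ← Finset.sum_sub_distrib]
    congr 1
    refine Finset.sum_congr rfl fun ℓ _ => ?_
    rw [Real.sq_sqrt (by have := (div_le_one hn').mpr (htn ℓ); linarith)]
    ring
  have hXT : |X - T * b / (Real.Gamma (1 + α) * (n : ℝ) ^ α)| ≤ K₁ * q ^ (α + 1) := by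
    have e : X - T * b / (Real.Gamma (1 + α) * (n : ℝ) ^ α)
        = ∑ ℓ, omegaCoef u ℓ * (1 - normIncBeta (1 - t ℓ / n) j α
            - b * (t ℓ / n) ^ α / Real.Gamma (1 + α)) := by
      simp_rw [mul_sub (omegaCoef u _) (_ - _)]
      rw [Finset.sum_sub_distrib, hT, Tzero, Finset.sum_mul, Finset.sum_div]
      congr 1
      refine Finset.sum_congr rfl fun ℓ _ => ?_
      rw [Real.div_rpow (ht0 ℓ) hn'.le]
      have : (n : ℝ) ^ α ≠ 0 := by positivity
      field_simp
    rw [e, hK₁, Finset.sum_mul]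
    refine (Finset.abs_sum_le_sum_abs _ _).trans (Finset.sum_le_sum fun ℓ _ => ?_)
    rw [abs_mul, mul_assoc]
    gcongr
    have h0 : 0 ≤ t ℓ / n := div_nonneg (ht0 ℓ) hn'.le
    refine (abs_one_sub_normIncBeta_sub_le hα hj h0 ((div_le_one hn').mpr (htn ℓ))).trans ?_
    rw [hqα1, Real.div_rpow (ht0 ℓ) hn'.le]
    have := Real.rpow_nonneg (ht0 ℓ) (α + 1)
    calc b * (j * (t ℓ ^ (α + 1) / (n : ℝ) ^ (α + 1))) / Real.Gamma α
        ≤ K * (j : ℝ) ^ α * (j * (t ℓ ^ (α + 1) / (n : ℝ) ^ (α + 1))) / Real.Gamma α := by gcongr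
      _ = _ := by ring
  have hXle : |X| ≤ K₃ * q ^ α := by
    have h1 : |T * b / (Real.Gamma (1 + α) * (n : ℝ) ^ α)|
        ≤ |T| * K / Real.Gamma (1 + α) * q ^ α := by
      rw [abs_div, abs_mul, abs_of_pos hbpos,
        abs_of_pos (by positivity : 0 < Real.Gamma (1 + α) * (n : ℝ) ^ α), hqα]
      calc _ ≤ |T| * (K * (j : ℝ) ^ α) / (Real.Gamma (1 + α) * (n : ℝ) ^ α) := by gcongr
        _ = _ := by field_simp
    have h2 : q ^ (α + 1) ≤ q ^ α := by
      rw [Real.rpow_add_one hq0.ne']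
      exact mul_le_of_le_one_right (by positivity) hq1
    have h3 := mul_le_mul_of_nonneg_left h2 hK₁0
    have h4 := abs_sub_abs_le_abs_sub X (T * b / (Real.Gamma (1 + α) * (n : ℝ) ^ α))
    have : 0 < q ^ α := by positivity
    rw [hK₃]
    linarith
  have hXΩ : |X| ≤ Ω / 2 := hXle.trans (by rw [mul_comm]; exact (le_div_iff₀ hK₃0).mp hqδ)
  have hlog := abs_log_sub_sub_le hΩ hXΩ
  have hX2 : X ^ 2 ≤ K₃ ^ 2 * q ^ (2 * α) := by
    rw [← sq_abs, mul_comm 2 α, Real.rpow_mul hq0.le, Real.rpow_two, ← mul_pow]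
    gcongr
  rw [harg]
  have e : Real.log (Ω - X) - (Real.log Ω - T / (Ω * Real.Gamma (1 + α)) / (n : ℝ) ^ α * b)
      = (Real.log (Ω - X) - (Real.log Ω - X / Ω))
        - (X - T * b / (Real.Gamma (1 + α) * (n : ℝ) ^ α)) / Ω := by
    have : (n : ℝ) ^ α ≠ 0 := by positivity
    field_simp
    ring
  rw [e]
  refine (abs_sub _ _).trans ?_
  rw [abs_div, abs_of_pos hΩ]
  have i1 : 2 * X ^ 2 / Ω ^ 2 ≤ 2 * K₃ ^ 2 / Ω ^ 2 * q ^ (2 * α) := by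
    calc _ ≤ 2 * (K₃ ^ 2 * q ^ (2 * α)) / Ω ^ 2 := by gcongr
      _ = _ := by ring
  have i2 : |X - T * b / (Real.Gamma (1 + α) * (n : ℝ) ^ α)| / Ω ≤ K₁ / Ω * q ^ (α + 1) := by
    calc _ ≤ K₁ * q ^ (α + 1) / Ω := by gcongr
      _ = _ := by ring
  have i3 : 0 ≤ K₁ / Ω * q ^ (2 * α) := by positivity
  have i4 : 0 ≤ 2 * K₃ ^ 2 / Ω ^ 2 * q ^ (α + 1) := by positivity
  linarith

lemma tendsto_ceil_rpow_atTop {γ : ℝ} (hγ : 0 < γ) :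
    Tendsto (fun n : ℕ => ⌈(n : ℝ) ^ γ⌉₊) atTop atTop :=
  tendsto_nat_ceil_atTop.comp ((tendsto_rpow_atTop hγ).comp tendsto_natCast_atTop_atTop)

lemma tendsto_ceil_rpow_div {γ : ℝ} (hγ1 : γ < 1) :
    Tendsto (fun n : ℕ => (⌈(n : ℝ) ^ γ⌉₊ : ℝ) / n) atTop (𝓝 0) := by
  have h1 : Tendsto (fun n : ℕ => (n : ℝ) ^ (-(1 - γ)) + 1 / (n : ℝ)) atTop (𝓝 0) := by
    have := ((tendsto_rpow_neg_atTop (by linarith : 0 < 1 - γ)).comp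
      (tendsto_natCast_atTop_atTop (R := ℝ))).add tendsto_one_div_atTop_nhds_zero_nat
    simpa using this
  refine squeeze_zero' (Eventually.of_forall fun n => by positivity) ?_ h1
  filter_upwards [eventually_gt_atTop 0] with n hn
  have hn' : (0 : ℝ) < n := by exact_mod_cast hn
  rw [neg_sub, Real.rpow_sub_one hn'.ne', ← add_div]
  gcongr
  exact (Nat.ceil_lt_add_one (by positivity)).le

theorem statement18 (m : ℕ) (hm : 0 < m) (α : ℝ) (hα : 0 < α)
    (t u : Fin m → ℝ) (ht : StrictAnti t) (ht0 : ∀ ℓ, 0 ≤ t ℓ) :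
    ∃ C > (0:ℝ), ∃ n₀ : ℕ, ∀ n ≥ n₀,
      |(∑ j ∈ Finset.Icc 1 (⌈(n : ℝ) ^ (α / (2 + α))⌉₊ - 1),
          Real.log (1 + ∑ ℓ : Fin m,
            omegaCoef u ℓ * normIncBeta (Real.sqrt (1 - t ℓ / n) ^ 2) j α))
        - (((n : ℝ) / Mpar n α - 1) * Real.log (OmegaTot u)
            - (Tzero α t u / (OmegaTot u * Real.Gamma (2 + α))) * ((n : ℝ) / Mpar n α ^ (1 + α))
            - (Tzero α t u / (OmegaTot u * Real.Gamma (1 + α))) * ((α - 2) / 2)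
                * (Mpar n α ^ α)⁻¹)|
        ≤ C * ((n : ℝ) / Mpar n α ^ (2 + α) + (n : ℝ) / Mpar n α ^ (1 + 2 * α)
            + Mpar n α ^ (1 - α) / n) := by
  obtain ⟨C₁, hC₁, δ, hδ, hterm⟩ := exists_abs_log_term_sub_le hα u ht0
  obtain ⟨C₂, hC₂, hsum⟩ := exists_abs_sum_gammaRatio_sub_le hα
  have hΩ : 0 < OmegaTot u := Real.exp_pos _
  have hΓ1 : 0 < Real.Gamma (1 + α) := Real.Gamma_pos_of_pos (by linarith)
  have hΓ2 : Real.Gamma (2 + α) = (1 + α) * Real.Gamma (1 + α) := by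
    rw [← Real.Gamma_add_one (by positivity)]; congr 1; ring
  set Ω := OmegaTot u
  set T := Tzero α t u
  set A := T / (Ω * Real.Gamma (1 + α)) with hA
  have hγ : 0 < α / (2 + α) := by positivity
  have hγ1 : α / (2 + α) < 1 := by rw [div_lt_one (by positivity)]; linarith
  refine ⟨C₁ + |A| * C₂, by positivity, ?_⟩
  rw [← eventually_atTop]
  have hqlim := tendsto_ceil_rpow_div hγ1
  have hqαlim : Tendsto (fun n : ℕ => ((⌈(n : ℝ) ^ (α / (2 + α))⌉₊ : ℝ) / n) ^ α) atTop (𝓝 0) := by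
    have := hqlim.rpow_const (p := α) (Or.inr hα.le)
    rwa [Real.zero_rpow hα.ne'] at this
  have htn : ∀ᶠ n : ℕ in atTop, ∀ ℓ, t ℓ ≤ n :=
    eventually_all.mpr fun ℓ => tendsto_natCast_atTop_atTop.eventually_ge_atTop (t ℓ)
  filter_upwards [(tendsto_ceil_rpow_atTop hγ).eventually hsum,
    (tendsto_ceil_rpow_atTop hγ).eventually (eventually_gt_atTop 0),
    hqlim.eventually (eventually_le_nhds one_pos), hqαlim.eventually (eventually_le_nhds hδ),
    htn, eventually_gt_atTop 0] with n hS hN hq1 hqδ htn hn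
  unfold Mpar
  set N := ⌈(n : ℝ) ^ (α / (2 + α))⌉₊
  have hn' : (0 : ℝ) < n := by exact_mod_cast hn
  have hN' : (0 : ℝ) < N := by exact_mod_cast hN
  have hM : (n : ℝ) * (N : ℝ)⁻¹ = ((N : ℝ) / n)⁻¹ := by rw [inv_div]; rfl
  rw [hM]
  set q := (N : ℝ) / n with hq
  have hq0 : 0 < q := by positivity
  have hNq : (N : ℝ) = n * q := by rw [hq]; field_simp
  have hqα : q ^ α = (N : ℝ) ^ α / (n : ℝ) ^ α := Real.div_rpow hN'.le hn'.le _
  simp only [Real.inv_rpow hq0.le, div_inv_eq_mul, inv_inv]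
  rw [← Real.rpow_neg hq0.le, neg_sub, Real.rpow_sub_one hq0.ne', hΓ2]
  have hlogsum : |∑ j ∈ Finset.Icc 1 (N - 1), Real.log (1 + ∑ ℓ : Fin m,
        omegaCoef u ℓ * normIncBeta (Real.sqrt (1 - t ℓ / n) ^ 2) j α)
      - ∑ j ∈ Finset.Icc 1 (N - 1), (Real.log Ω - A / (n : ℝ) ^ α * gammaRatio α j)|
      ≤ C₁ * (n * q ^ (2 + α) + n * q ^ (1 + 2 * α)) := by
    rw [← Finset.sum_sub_distrib]
    refine (Finset.abs_sum_le_sum_abs _ _).trans ?_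
    have hle : ∀ j ∈ Finset.Icc 1 (N - 1), |Real.log (1 + ∑ ℓ : Fin m,
        omegaCoef u ℓ * normIncBeta (Real.sqrt (1 - t ℓ / n) ^ 2) j α)
      - (Real.log Ω - A / (n : ℝ) ^ α * gammaRatio α j)|
        ≤ C₁ * (q ^ (α + 1) + q ^ (2 * α)) := by
      intro j hj
      rw [Finset.mem_Icc] at hj
      have hjq : (j : ℝ) / n ≤ q := by
        have : (j : ℝ) ≤ N := by exact_mod_cast (by omega : j ≤ N)
        rw [hq]; gcongr
      refine (hterm n hn htn j (by omega) (hjq.trans hq1)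
        ((Real.rpow_le_rpow (by positivity) hjq hα.le).trans hqδ)).trans ?_
      gcongr
    refine (Finset.sum_le_card_nsmul _ _ _ hle).trans ?_
    rw [Nat.card_Icc, nsmul_eq_mul]
    have hcard : ((N - 1 + 1 - 1 : ℕ) : ℝ) ≤ n * q := by
      rw [← hNq]; exact_mod_cast (by omega : N - 1 + 1 - 1 ≤ N)
    calc _ ≤ n * q * (C₁ * (q ^ (α + 1) + q ^ (2 * α))) := by gcongr
      _ = _ := by
        rw [show 2 + α = (α + 1) + 1 by ring, show 1 + 2 * α = 2 * α + 1 by ring,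
          Real.rpow_add_one hq0.ne' (α + 1), Real.rpow_add_one hq0.ne' (2 * α)]
        ring
  have hmain : ∑ j ∈ Finset.Icc 1 (N - 1), (Real.log Ω - A / (n : ℝ) ^ α * gammaRatio α j)
      - ((n * q - 1) * Real.log Ω - T / (Ω * ((1 + α) * Real.Gamma (1 + α))) * (n * q ^ (1 + α))
        - A * ((α - 2) / 2) * q ^ α)
      = -(A / (n : ℝ) ^ α) * (∑ j ∈ Finset.Icc 1 (N - 1), gammaRatio α j
          - ((N : ℝ) * (N : ℝ) ^ α / (1 + α) + (α - 2) / 2 * (N : ℝ) ^ α)) := by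
    rw [Finset.sum_sub_distrib, ← Finset.mul_sum, Finset.sum_const, Nat.card_Icc, nsmul_eq_mul,
      Nat.add_sub_cancel, Nat.cast_sub hN, add_comm 1 α, Real.rpow_add_one hq0.ne', hqα,
      ← hNq, hA, add_comm α 1, hq]
    have : (n : ℝ) ^ α ≠ 0 := by positivity
    have : 1 + α ≠ 0 := by positivity
    push_cast
    field_simp
    ring
  have hmainle := abs_mul (-(A / (n : ℝ) ^ α)) (∑ j ∈ Finset.Icc 1 (N - 1), gammaRatio α j
          - ((N : ℝ) * (N : ℝ) ^ α / (1 + α) + (α - 2) / 2 * (N : ℝ) ^ α))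
  rw [← hmain, abs_neg, abs_div, abs_of_pos (by positivity : 0 < (n : ℝ) ^ α)] at hmainle
  have h2 : |A| / (n : ℝ) ^ α * |∑ j ∈ Finset.Icc 1 (N - 1), gammaRatio α j
          - ((N : ℝ) * (N : ℝ) ^ α / (1 + α) + (α - 2) / 2 * (N : ℝ) ^ α)|
      ≤ |A| * C₂ * (q ^ α / q / n) := by
    calc _ ≤ |A| / (n : ℝ) ^ α * (C₂ * ((N : ℝ) ^ α / N)) := by gcongr
      _ = _ := by
        rw [hqα, hNq]
        field_simp
  refine (abs_sub_le _ _ _).trans ((add_le_add hlogsum (hmainle.trans_le h2)).trans ?_)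
  have p1 : 0 ≤ n * q ^ (2 + α) + n * q ^ (1 + 2 * α) := by positivity
  have p2 : 0 ≤ q ^ α / q / n := by positivity
  have p3 := mul_nonneg (by positivity : 0 ≤ |A| * C₂) p1
  have p4 := mul_nonneg hC₁.le p2
  linarith
end
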